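/- Suppose the operator L satisfies the positive maximum principle on M₊(E). Then q₂ admits a (β,π)-representation: there exist a function π : E×E → ℝ₊ with π(x,x) = 0 for all x ∈ E and a symmetric function β : E×E → ℝ with β(x,x) ≥ 0 for all x ∈ E, both bounded and continuous on E×E minus the diagonal, such that q₂(g,g)(x,y) = ½(π(x,y)g(x)² + π(y,x)g(y)² + 2β(x,y)g(x)g(y)) for all g ∈ C(E) and x,y ∈ E, and such that for every n ≥ 1, all x₁,…,x_n ∈ E and all c₁,…,c_n > 0 the n×n matrix with entries β(x_i,x_j) plus the diagonal matrix with entries Σ_{j=1}^n (c_j/c_i)π(x_i,x_j) is positive semidefinite. -/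

import Mathlib

open MeasureTheory Topology

/-- The topological support of a measure: points all of whose open neighborhoods
have positive measure. -/
def mSupport {E : Type*} [TopologicalSpace E] [MeasurableSpace E]
    (ν : Measure E) : Set E :=
  {x : E | ∀ U : Set E, IsOpen U → x ∈ U → 0 < ν U}

/-- The action of the operator `L` (with parameters `b₀, b₁, q₀, q₁, q₂`) on the cylindrical
function `ν ↦ φ(⟨g₁,ν⟩, …, ⟨g_m,ν⟩)`, evaluated at `ν`. -/
noncomputable def Lapp {E : Type*} [MetricSpace E] [MeasurableSpace E]
    (b₀ : C(E, ℝ) →ₗ[ℝ] ℝ) (b₁ : C(E, ℝ) →ₗ[ℝ] C(E, ℝ))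
    (q₀ : C(E, ℝ) →ₗ[ℝ] C(E, ℝ) →ₗ[ℝ] ℝ)
    (q₁ : C(E, ℝ) →ₗ[ℝ] C(E, ℝ) →ₗ[ℝ] C(E, ℝ))
    (q₂ : C(E, ℝ) →ₗ[ℝ] C(E, ℝ) →ₗ[ℝ] C(E × E, ℝ))
    (m : ℕ) (φ : (Fin m → ℝ) → ℝ) (g : Fin m → C(E, ℝ)) (ν : FiniteMeasure E) : ℝ :=
  (∑ i, fderiv ℝ φ (fun k => ∫ x, g k x ∂(ν : Measure E)) (Pi.single i 1) *
      (b₀ (g i) + ∫ x, b₁ (g i) x ∂(ν : Measure E))) +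
  (1 / 2) * ∑ i, ∑ j,
    (fderiv ℝ (fun w => fderiv ℝ φ w (Pi.single i 1))
        (fun k => ∫ x, g k x ∂(ν : Measure E)) (Pi.single j 1)) *
      (q₀ (g i) (g j) + (∫ x, q₁ (g i) (g j) x ∂(ν : Measure E)) +
        ∫ p, q₂ (g i) (g j) p ∂((ν : Measure E).prod (ν : Measure E)))

/-- `φ : ℝ^m → ℝ` is a polynomial function. -/
def IsPolyFn {m : ℕ} (φ : (Fin m → ℝ) → ℝ) : Prop :=
  ∃ P : MvPolynomial (Fin m) ℝ, ∀ v, φ v = MvPolynomial.eval v P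

/-- The operator `L` satisfies the positive maximum principle on `M₊(E)`: for every
cylindrical function `f(ν) = φ(⟨g₁,ν⟩, …, ⟨g_m,ν⟩)` whose outer function `φ` is smooth and
either a polynomial or compactly supported, and every global maximizer `ν*` of `f` over
`M₊(E)` with `f(ν*) ≥ 0`, one has `Lf(ν*) ≤ 0`. -/
def SatisfiesPMP {E : Type*} [MetricSpace E] [MeasurableSpace E]
    (b₀ : C(E, ℝ) →ₗ[ℝ] ℝ) (b₁ : C(E, ℝ) →ₗ[ℝ] C(E, ℝ))
    (q₀ : C(E, ℝ) →ₗ[ℝ] C(E, ℝ) →ₗ[ℝ] ℝ)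
    (q₁ : C(E, ℝ) →ₗ[ℝ] C(E, ℝ) →ₗ[ℝ] C(E, ℝ))
    (q₂ : C(E, ℝ) →ₗ[ℝ] C(E, ℝ) →ₗ[ℝ] C(E × E, ℝ)) : Prop :=
  ∀ (m : ℕ) (φ : (Fin m → ℝ) → ℝ), ContDiff ℝ (⊤ : ℕ∞) φ →
    (IsPolyFn φ ∨ HasCompactSupport φ) →
    ∀ (g : Fin m → C(E, ℝ)) (νstar : FiniteMeasure E),
      (∀ ν : FiniteMeasure E,
        φ (fun i => ∫ x, g i x ∂(ν : Measure E)) ≤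
          φ (fun i => ∫ x, g i x ∂(νstar : Measure E))) →
      0 ≤ φ (fun i => ∫ x, g i x ∂(νstar : Measure E)) →
      Lapp b₀ b₁ q₀ q₁ q₂ m φ g νstar ≤ 0

/-- A real quadratic polynomial that is nonnegative on `[0, ∞)` has nonnegative leading
coefficient. -/
lemma leadingCoeff_nonneg_of_quadratic_nonneg {a b c : ℝ}
    (h : ∀ t : ℝ, 0 ≤ t → 0 ≤ a + t * b + t ^ 2 * c) : 0 ≤ c := by
  by_contra! hc
  have hpos : 0 < -c := by linarith
  set t : ℝ := (|a| + |b| + 1) / (-c) + 1 with ht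
  have h0 : 0 ≤ (|a| + |b| + 1) / (-c) := by positivity
  have h1 : 1 ≤ t := by linarith
  have h2 : t * (-c) = |a| + |b| + 1 - c := by
    rw [ht, add_mul, div_mul_cancel₀ _ hpos.ne']
    ring
  have h3 := h t (by linarith)
  nlinarith [le_abs_self a, le_abs_self b, abs_nonneg a, abs_nonneg b, mul_nonneg h0 hpos.le]

/-- An affine function bounded below on `ℝ` is constant. -/
lemma slope_eq_zero_of_affine_nonneg {a b : ℝ} (h : ∀ t : ℝ, 0 ≤ a + t * b) : b = 0 := by
  by_contra hb
  have := h (-(a + 1) / b)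
  rw [div_mul_cancel₀ _ hb] at this
  linarith

section AtomicMeasures

variable {E : Type*} [MetricSpace E] [MeasurableSpace E] [BorelSpace E]

/-- The finite atomic measure `∑ i, c i • δ_{x i}`. -/
noncomputable def atomicMeasure {n : ℕ} (x : Fin n → E) (c : Fin n → NNReal) : FiniteMeasure E :=
  ⟨∑ i, c i • Measure.dirac (x i), inferInstance⟩

lemma integral_atomicMeasure {n : ℕ} (x : Fin n → E) (c : Fin n → NNReal) (f : E → ℝ) :
    ∫ z, f z ∂(atomicMeasure x c : Measure E) = ∑ i, (c i : ℝ) * f (x i) := by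
  change ∫ z, f z ∂(∑ i, c i • Measure.dirac (x i)) = _
  rw [integral_finsetSum_measure]
  · simp [integral_smul_nnreal_measure, NNReal.smul_def]
  · intro i _
    exact (integrable_dirac (by simp)).smul_measure_nnreal

lemma integral_prod_atomicMeasure [CompactSpace E] {n : ℕ} (x : Fin n → E) (c : Fin n → NNReal)
    (f : C(E × E, ℝ)) :
    ∫ p, f p ∂((atomicMeasure x c : Measure E).prod (atomicMeasure x c : Measure E)) =
      ∑ i, ∑ j, (c i : ℝ) * c j * f (x i, x j) := by
  rw [integral_prod, integral_atomicMeasure]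
  · simp_rw [integral_atomicMeasure, Finset.mul_sum, mul_assoc]
  · exact f.continuous.integrable_of_hasCompactSupport (HasCompactSupport.of_compactSpace f)

end AtomicMeasures

section OuterPolynomial

lemma hasFDerivAt_polynomial_apply (P : Polynomial ℝ) (v : Fin 1 → ℝ) :
    HasFDerivAt (fun w : Fin 1 → ℝ => P.eval (w 0))
      (P.derivative.eval (v 0) • ContinuousLinearMap.proj (R := ℝ) (φ := fun _ : Fin 1 => ℝ) 0)
      v :=
  HasDerivAt.comp_hasFDerivAt (h₂ := fun t => P.eval t) v (P.hasDerivAt (v 0))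
    (hasFDerivAt_apply (𝕜 := ℝ) (0 : Fin 1) v)

lemma fderiv_polynomial_apply (P : Polynomial ℝ) (v : Fin 1 → ℝ) (i : Fin 1) :
    fderiv ℝ (fun w : Fin 1 → ℝ => P.eval (w 0)) v (Pi.single i 1) =
      P.derivative.eval (v 0) := by
  rw [(hasFDerivAt_polynomial_apply P v).fderiv, Subsingleton.elim i 0]
  simp

end OuterPolynomial

section PositiveMaximumPrinciple

variable {E : Type*} [MetricSpace E] [MeasurableSpace E]
  {b₀ : C(E, ℝ) →ₗ[ℝ] ℝ} {b₁ : C(E, ℝ) →ₗ[ℝ] C(E, ℝ)}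
  {q₀ : C(E, ℝ) →ₗ[ℝ] C(E, ℝ) →ₗ[ℝ] ℝ}
  {q₁ : C(E, ℝ) →ₗ[ℝ] C(E, ℝ) →ₗ[ℝ] C(E, ℝ)}
  {q₂ : C(E, ℝ) →ₗ[ℝ] C(E, ℝ) →ₗ[ℝ] C(E × E, ℝ)}

/-- The positive maximum principle for functions `ν ↦ P ⟨g, ν⟩` with `P` a polynomial. -/
lemma SatisfiesPMP.polynomial (hPMP : SatisfiesPMP b₀ b₁ q₀ q₁ q₂) (P : Polynomial ℝ)
    (g : C(E, ℝ)) (μ : FiniteMeasure E)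
    (hmax : ∀ ν : FiniteMeasure E,
      P.eval (∫ x, g x ∂(ν : Measure E)) ≤ P.eval (∫ x, g x ∂(μ : Measure E)))
    (hnonneg : 0 ≤ P.eval (∫ x, g x ∂(μ : Measure E))) :
    P.derivative.eval (∫ x, g x ∂(μ : Measure E)) *
        (b₀ g + ∫ x, b₁ g x ∂(μ : Measure E)) +
      (1 / 2) * (P.derivative.derivative.eval (∫ x, g x ∂(μ : Measure E)) *
        (q₀ g g + (∫ x, q₁ g g x ∂(μ : Measure E)) +
          ∫ p, q₂ g g p ∂((μ : Measure E).prod (μ : Measure E)))) ≤ 0 := by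
  have hsmooth : ContDiff ℝ (⊤ : ℕ∞) (fun w : Fin 1 → ℝ => P.eval (w 0)) :=
    by
    simpa [Polynomial.coe_aeval_eq_eval, Function.comp_def] using
      (P.contDiff_aeval (𝕜 := ℝ) _).comp (contDiff_apply ℝ ℝ (0 : Fin 1))
  have hpoly : IsPolyFn (fun w : Fin 1 → ℝ => P.eval (w 0)) := by
    refine ⟨Polynomial.aeval (MvPolynomial.X 0) P, fun v => ?_⟩
    rw [← MvPolynomial.coe_aeval_eq_eval, RingHom.coe_coe, ← Polynomial.aeval_algHom_apply]
    simp [Polynomial.coe_aeval_eq_eval]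
  have h := hPMP 1 (fun w => P.eval (w 0)) hsmooth (Or.inl hpoly) (fun _ => g) μ hmax hnonneg
  simpa only [Lapp, fderiv_polynomial_apply, Finset.univ_unique, Finset.sum_singleton] using h

lemma SatisfiesPMP.diffusion_nonneg (hPMP : SatisfiesPMP b₀ b₁ q₀ q₁ q₂) (g : C(E, ℝ))
    (μ : FiniteMeasure E) :
    0 ≤ q₀ g g + (∫ x, q₁ g g x ∂(μ : Measure E)) +
      ∫ p, q₂ g g p ∂((μ : Measure E).prod (μ : Measure E)) := by
  have h := hPMP.polynomial (-(Polynomial.X - Polynomial.C (∫ x, g x ∂(μ : Measure E))) ^ 2) g μ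
    (fun ν => by simp [sq_nonneg]) (by simp)
  simp [Polynomial.derivative_pow] at h
  linarith

lemma SatisfiesPMP.diffusion_eq_zero (hPMP : SatisfiesPMP b₀ b₁ q₀ q₁ q₂) {g : C(E, ℝ)}
    (hg : 0 ≤ g) {μ : FiniteMeasure E} (hμ : ∫ x, g x ∂(μ : Measure E) = 0) :
    q₀ g g + (∫ x, q₁ g g x ∂(μ : Measure E)) +
      ∫ p, q₂ g g p ∂((μ : Measure E).prod (μ : Measure E)) = 0 := by
  refine slope_eq_zero_of_affine_nonneg (a := b₀ g + ∫ x, b₁ g x ∂(μ : Measure E)) fun t => ?_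
  have h := hPMP.polynomial
    (-(Polynomial.X * (1 + Polynomial.C (t / 2) * Polynomial.X) ^ 2)) g μ
    (fun ν => by
      have : 0 ≤ ∫ x, g x ∂(ν : Measure E) := integral_nonneg hg
      simp only [hμ, Polynomial.eval_neg, Polynomial.eval_mul, Polynomial.eval_X, zero_mul,
        neg_zero, Polynomial.eval_pow]
      exact neg_nonpos.2 (mul_nonneg this (sq_nonneg _)))
    (by simp [hμ])
  simp [Polynomial.derivative_pow, hμ] at h
  linarith

variable [CompactSpace E] [BorelSpace E]

lemma SatisfiesPMP.sum_nonneg (hPMP : SatisfiesPMP b₀ b₁ q₀ q₁ q₂) {n : ℕ} (x : Fin n → E)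
    (c : Fin n → NNReal) (g : C(E, ℝ)) :
    0 ≤ ∑ i, ∑ j, (c i : ℝ) * c j * q₂ g g (x i, x j) := by
  refine leadingCoeff_nonneg_of_quadratic_nonneg (a := q₀ g g)
    (b := ∑ i, (c i : ℝ) * q₁ g g (x i)) fun t ht => ?_
  have h := hPMP.diffusion_nonneg g (atomicMeasure x fun i => t.toNNReal * c i)
  rw [integral_atomicMeasure, integral_prod_atomicMeasure] at h
  convert h using 2
  · simp [Finset.mul_sum, ht, mul_assoc]
  · simp only [Finset.mul_sum, NNReal.coe_mul, Real.coe_toNNReal t ht]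
    exact Finset.sum_congr rfl fun i _ => Finset.sum_congr rfl fun j _ => by ring

lemma SatisfiesPMP.sum_eq_zero_of_nonneg (hPMP : SatisfiesPMP b₀ b₁ q₀ q₁ q₂) {n : ℕ}
    (x : Fin n → E) (c : Fin n → NNReal) {g : C(E, ℝ)} (hg : 0 ≤ g) (hgx : ∀ i, g (x i) = 0) :
    ∑ i, ∑ j, (c i : ℝ) * c j * q₂ g g (x i, x j) = 0 := by
  refine le_antisymm (neg_nonneg.1 ?_) (hPMP.sum_nonneg x c g)
  refine leadingCoeff_nonneg_of_quadratic_nonneg (a := -q₀ g g)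
    (b := -∑ i, (c i : ℝ) * q₁ g g (x i)) fun t ht => ?_
  have h := hPMP.diffusion_eq_zero hg (μ := atomicMeasure x fun i => t.toNNReal * c i)
    (by simp [integral_atomicMeasure, hgx])
  rw [integral_atomicMeasure, integral_prod_atomicMeasure] at h
  simp only [NNReal.coe_mul, Real.coe_toNNReal t ht] at h
  have h₁ : ∑ i, t * (c i : ℝ) * q₁ g g (x i) = t * ∑ i, (c i : ℝ) * q₁ g g (x i) := by
    simp [Finset.mul_sum, mul_assoc]
  have h₂ : ∑ i, ∑ j, t * (c i : ℝ) * (t * c j) * q₂ g g (x i, x j) =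
      t ^ 2 * ∑ i, ∑ j, (c i : ℝ) * c j * q₂ g g (x i, x j) := by
    simp only [Finset.mul_sum]
    exact Finset.sum_congr rfl fun i _ => Finset.sum_congr rfl fun j _ => by ring
  rw [h₁, h₂] at h
  linarith

lemma SatisfiesPMP.sum_eq_zero_of_nonneg_left (hPMP : SatisfiesPMP b₀ b₁ q₀ q₁ q₂)
    (hq₂ : ∀ g h : C(E, ℝ), q₂ g h = q₂ h g) {n : ℕ} (x : Fin n → E) (c : Fin n → NNReal)
    {g : C(E, ℝ)} (hg : 0 ≤ g) (hgx : ∀ i, g (x i) = 0) (h : C(E, ℝ)) :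
    ∑ i, ∑ j, (c i : ℝ) * c j * q₂ g h (x i, x j) = 0 := by
  refine slope_eq_zero_of_affine_nonneg
    (a := ∑ i, ∑ j, (c i : ℝ) * c j * q₂ h h (x i, x j)) fun t => ?_
  have key := hPMP.sum_nonneg x c (h + (t / 2) • g)
  have hzero := hPMP.sum_eq_zero_of_nonneg x c hg hgx
  have hexp : ∑ i, ∑ j, (c i : ℝ) * c j * q₂ (h + (t / 2) • g) (h + (t / 2) • g) (x i, x j) =
      ∑ i, ∑ j, (c i : ℝ) * c j * q₂ h h (x i, x j) +
        t * ∑ i, ∑ j, (c i : ℝ) * c j * q₂ g h (x i, x j) +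
        t ^ 2 / 4 * ∑ i, ∑ j, (c i : ℝ) * c j * q₂ g g (x i, x j) := by
    simp only [Finset.mul_sum, ← Finset.sum_add_distrib]
    refine Finset.sum_congr rfl fun i _ => Finset.sum_congr rfl fun j _ => ?_
    simp only [map_add, map_smul, LinearMap.add_apply, LinearMap.smul_apply,
      ContinuousMap.add_apply, ContinuousMap.smul_apply, smul_eq_mul, hq₂ h g]
    ring
  rw [hexp, hzero] at key
  linarith

/-- `q₂ g h (x, y)` vanishes when `g` is nonnegative and vanishes at `x` and `y`. -/
lemma SatisfiesPMP.apply_eq_zero_of_nonneg (hPMP : SatisfiesPMP b₀ b₁ q₀ q₁ q₂)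
    (hq₂ : ∀ g h : C(E, ℝ), q₂ g h = q₂ h g)
    (hq₂val : ∀ (g h : C(E, ℝ)) (x y : E), q₂ g h (x, y) = q₂ g h (y, x))
    {g : C(E, ℝ)} (hg : 0 ≤ g) {x y : E} (hx : g x = 0) (hy : g y = 0) (h : C(E, ℝ)) :
    q₂ g h (x, y) = 0 := by
  have diag : ∀ z, g z = 0 → q₂ g h (z, z) = 0 := fun z hz => by
    simpa using hPMP.sum_eq_zero_of_nonneg_left hq₂ ![z] ![1] hg (by simpa using hz) h
  have key := hPMP.sum_eq_zero_of_nonneg_left hq₂ ![x, y] ![1, 1] hg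
    (by simp [Fin.forall_fin_two, hx, hy]) h
  simp [Fin.sum_univ_two, diag x hx, diag y hy, hq₂val g h y x] at key
  exact key

/-- `q₂ g h (x, y)` vanishes when `g` vanishes at `x` and `y`. -/
lemma SatisfiesPMP.apply_eq_zero (hPMP : SatisfiesPMP b₀ b₁ q₀ q₁ q₂)
    (hq₂ : ∀ g h : C(E, ℝ), q₂ g h = q₂ h g)
    (hq₂val : ∀ (g h : C(E, ℝ)) (x y : E), q₂ g h (x, y) = q₂ g h (y, x))
    (g h : C(E, ℝ)) (x y : E) (hx : g x = 0) (hy : g y = 0) :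
    q₂ g h (x, y) = 0 := by
  have hsub : g = g ⊔ 0 - (-g) ⊔ 0 := by
    ext z
    rcases le_total (g z) 0 with hz | hz <;> simp [hz]
  rw [hsub, map_sub, LinearMap.sub_apply, ContinuousMap.sub_apply,
    hPMP.apply_eq_zero_of_nonneg hq₂ hq₂val le_sup_right (by simp [hx]) (by simp [hy]),
    hPMP.apply_eq_zero_of_nonneg hq₂ hq₂val le_sup_right (by simp [hx]) (by simp [hy]), sub_zero]

end PositiveMaximumPrinciple

section Interpolation

variable {E : Type*} [MetricSpace E]

lemma exists_continuousMap_eqOn_finite {S : Set E} (hS : S.Finite) (u : E → ℝ) :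
    ∃ g : C(E, ℝ), ∀ z ∈ S, g z = u z := by
  have : DiscreteTopology S := hS.isDiscrete.to_subtype
  obtain ⟨g, hg⟩ := ContinuousMap.exists_restrict_eq hS.isClosed
    (⟨fun z : S => u z, continuous_of_discreteTopology⟩ : C(S, ℝ))
  exact ⟨g, fun z hz => congrArg (fun f : C(S, ℝ) => f ⟨z, hz⟩) hg⟩

/-- Two distinct points have neighborhoods on which a continuous function with values in `[0, 1]`
is identically `1` and `0` respectively. -/
lemma exists_continuousMap_eventually_one_zero {x y : E} (hxy : x ≠ y) :
    ∃ e : C(E, ℝ), (∀ᶠ z in 𝓝 x, e z = 1) ∧ (∀ᶠ z in 𝓝 y, e z = 0) ∧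
      ∀ z, e z ∈ Set.Icc (0 : ℝ) 1 := by
  have hd : 0 < dist x y := dist_pos.2 hxy
  have hdisj : Disjoint (Metric.closedBall y (dist x y / 3))
      (Metric.closedBall x (dist x y / 3)) :=
    Metric.closedBall_disjoint_closedBall (by rw [dist_comm y x]; linarith)
  obtain ⟨e, he₀, he₁, he⟩ := exists_continuous_zero_one_of_isClosed
    Metric.isClosed_closedBall Metric.isClosed_closedBall hdisj
  exact ⟨e, Filter.mem_of_superset (Metric.closedBall_mem_nhds x (by positivity)) he₁,
    Filter.mem_of_superset (Metric.closedBall_mem_nhds y (by positivity)) he₀, he⟩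

end Interpolation

section BilinearForms

variable {E : Type*} [MetricSpace E] {q : C(E, ℝ) →ₗ[ℝ] C(E, ℝ) →ₗ[ℝ] C(E × E, ℝ)}

lemma apply_congr_of_eq_at (hq : ∀ g h : C(E, ℝ), q g h = q h g)
    (hzero : ∀ (g h : C(E, ℝ)) (x y : E), g x = 0 → g y = 0 → q g h (x, y) = 0)
    {g g' h h' : C(E, ℝ)} {x y : E} (hgx : g x = g' x) (hgy : g y = g' y) (hhx : h x = h' x)
    (hhy : h y = h' y) : q g h (x, y) = q g' h' (x, y) := by
  have h₁ := hzero (g - g') h x y (by simp [hgx]) (by simp [hgy])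
  have h₂ := hzero (h - h') g' x y (by simp [hhx]) (by simp [hhy])
  simp only [map_sub, LinearMap.sub_apply, ContinuousMap.sub_apply] at h₁ h₂
  rw [hq h g', hq h' g'] at h₂
  linarith

lemma apply_eq_of_separating (hq : ∀ g h : C(E, ℝ), q g h = q h g)
    (hzero : ∀ (g h : C(E, ℝ)) (x y : E), g x = 0 → g y = 0 → q g h (x, y) = 0)
    {e e' : C(E, ℝ)} {x y : E} (hx : e x = 1) (hy : e y = 0) (hx' : e' x = 0) (hy' : e' y = 1)
    (g h : C(E, ℝ)) :
    q g h (x, y) = g x * h x * q e e (x, y) + g y * h y * q e' e' (x, y) +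
      (g x * h y + g y * h x) * q e e' (x, y) := by
  rw [apply_congr_of_eq_at hq hzero (g := g) (g' := g x • e + g y • e') (h := h)
    (h' := h x • e + h y • e') (by simp [hx, hx']) (by simp [hy, hy']) (by simp [hx, hx'])
    (by simp [hy, hy'])]
  simp only [map_add, map_smul, LinearMap.add_apply, LinearMap.smul_apply,
    ContinuousMap.add_apply, ContinuousMap.smul_apply, smul_eq_mul, hq e' e]
  ring

lemma apply_diag_eq (hq : ∀ g h : C(E, ℝ), q g h = q h g)
    (hzero : ∀ (g h : C(E, ℝ)) (x y : E), g x = 0 → g y = 0 → q g h (x, y) = 0)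
    (g : C(E, ℝ)) (x : E) : q g g (x, x) = g x ^ 2 * q 1 1 (x, x) := by
  have h₁ : g x = (g x • (1 : C(E, ℝ))) x := by simp
  rw [apply_congr_of_eq_at hq hzero h₁ h₁ h₁ h₁]
  simp [sq, mul_assoc]

/-- By the Banach–Steinhaus theorem, `q` is bounded off the diagonal. -/
lemma exists_bound_offDiag [CompactSpace E] (hq : ∀ g h : C(E, ℝ), q g h = q h g)
    (hzero : ∀ (g h : C(E, ℝ)) (x y : E), g x = 0 → g y = 0 → q g h (x, y) = 0) :
    ∃ C : ℝ, ∀ x y : E, x ≠ y → ∀ g h : C(E, ℝ), |q g h (x, y)| ≤ C * ‖g‖ * ‖h‖ := by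
  have hbound : ∀ p : {p : E × E // p.1 ≠ p.2}, ∃ K : ℝ, ∀ g h : C(E, ℝ),
      |q g h p| ≤ K * ‖g‖ * ‖h‖ := by
    rintro ⟨⟨x, y⟩, hxy⟩
    obtain ⟨e, he, he', -⟩ := exists_continuousMap_eventually_one_zero hxy
    have hx : e x = 1 := he.self_of_nhds
    have hy : e y = 0 := he'.self_of_nhds
    refine ⟨|q e e (x, y)| + |q (1 - e) (1 - e) (x, y)| + 2 * |q e (1 - e) (x, y)|,
      fun g h => ?_⟩
    have key : ∀ a b : E, |g a * h b| ≤ ‖g‖ * ‖h‖ := fun a b => by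
      rw [abs_mul]
      exact mul_le_mul (g.norm_coe_le_norm a) (h.norm_coe_le_norm b) (abs_nonneg _)
        (norm_nonneg _)
    change |q g h (x, y)| ≤ _
    rw [apply_eq_of_separating hq hzero hx hy (e' := 1 - e) (by simp [hx]) (by simp [hy])]
    calc _ ≤ |g x * h x * q e e (x, y)| + |g y * h y * q (1 - e) (1 - e) (x, y)| +
          |(g x * h y + g y * h x) * q e (1 - e) (x, y)| := abs_add_three _ _ _
      _ ≤ ‖g‖ * ‖h‖ * |q e e (x, y)| + ‖g‖ * ‖h‖ * |q (1 - e) (1 - e) (x, y)| +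
          (‖g‖ * ‖h‖ + ‖g‖ * ‖h‖) * |q e (1 - e) (x, y)| := by
        simp only [abs_mul (_ * _ : ℝ) (q _ _ _), abs_mul (_ + _ : ℝ) (q _ _ _)]
        gcongr
        · exact key x x
        · exact key y y
        · exact (abs_add_le _ _).trans (add_le_add (key x y) (key y x))
      _ = _ := by ring
  choose K hK using hbound
  let B : {p : E × E // p.1 ≠ p.2} → C(E, ℝ) →L[ℝ] C(E, ℝ) →L[ℝ] ℝ := fun p =>
    (q.compr₂ ((ContinuousMap.evalCLM ℝ (p : E × E) : C(E × E, ℝ) →L[ℝ] ℝ) :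
      C(E × E, ℝ) →ₗ[ℝ] ℝ)).mkContinuous₂ (K p) (hK p)
  have hB : ∀ p g h, B p g h = q g h p := fun _ _ _ => rfl
  have hpartial : ∀ g, ∃ C, ∀ p, ‖B p g‖ ≤ C := fun g =>
    banach_steinhaus fun h => ⟨‖q g h‖, fun p => by
      rw [hB]
      exact (q g h).norm_coe_le_norm p⟩
  obtain ⟨C, hC⟩ := banach_steinhaus (σ₁₂ := RingHom.id ℝ) (F := C(E, ℝ) →L[ℝ] ℝ) (g := B) hpartial
  refine ⟨C, fun x y hxy g h => ?_⟩
  exact (B ⟨(x, y), hxy⟩).le_of_opNorm₂_le_of_le (hC _) le_rfl le_rfl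

end BilinearForms

section Coefficients

variable {E : Type*} [MetricSpace E]

/-- A continuous function equal to `1` near `p.1` and to `0` near `p.2`, when `p.1 ≠ p.2`. -/
noncomputable def separator (p : {p : E × E // p.1 ≠ p.2}) : C(E, ℝ) :=
  (exists_continuousMap_eventually_one_zero p.2).choose

lemma separator_fst {x y : E} (hxy : x ≠ y) : separator ⟨(x, y), hxy⟩ x = 1 :=
  (exists_continuousMap_eventually_one_zero hxy).choose_spec.1.self_of_nhds

lemma separator_snd {x y : E} (hxy : x ≠ y) : separator ⟨(x, y), hxy⟩ y = 0 :=
  (exists_continuousMap_eventually_one_zero hxy).choose_spec.2.1.self_of_nhds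

lemma norm_separator_le_one [CompactSpace E] (p : {p : E × E // p.1 ≠ p.2}) :
    ‖separator p‖ ≤ 1 := by
  refine (ContinuousMap.norm_le _ zero_le_one).2 fun z => ?_
  have h : separator p z ∈ Set.Icc (0 : ℝ) 1 :=
    (exists_continuousMap_eventually_one_zero p.2).choose_spec.2.2 z
  exact abs_le.2 ⟨by linarith [h.1], h.2⟩

open Classical in
/-- The coefficient `π` of a bilinear map `q`. -/
noncomputable def piCoeff (q : C(E, ℝ) →ₗ[ℝ] C(E, ℝ) →ₗ[ℝ] C(E × E, ℝ)) (p : E × E) : ℝ :=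
  if h : p.1 ≠ p.2 then 2 * q (separator ⟨p, h⟩) (separator ⟨p, h⟩) p else 0

/-- The coefficient `β` of a bilinear map `q`. -/
noncomputable def betaCoeff (q : C(E, ℝ) →ₗ[ℝ] C(E, ℝ) →ₗ[ℝ] C(E × E, ℝ)) (p : E × E) : ℝ :=
  q 1 1 p - (piCoeff q p + piCoeff q p.swap) / 2

variable {q : C(E, ℝ) →ₗ[ℝ] C(E, ℝ) →ₗ[ℝ] C(E × E, ℝ)}

lemma piCoeff_diag (x : E) : piCoeff q (x, x) = 0 := by
  simp [piCoeff]

lemma betaCoeff_diag (x : E) : betaCoeff q (x, x) = q 1 1 (x, x) := by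
  simp [betaCoeff, piCoeff_diag]

lemma betaCoeff_symm (hqval : ∀ (g h : C(E, ℝ)) (x y : E), q g h (x, y) = q g h (y, x))
    (x y : E) : betaCoeff q (x, y) = betaCoeff q (y, x) := by
  simp [betaCoeff, hqval 1 1 x y, add_comm]

lemma piCoeff_eq (hq : ∀ g h : C(E, ℝ), q g h = q h g)
    (hzero : ∀ (g h : C(E, ℝ)) (x y : E), g x = 0 → g y = 0 → q g h (x, y) = 0)
    {g : C(E, ℝ)} {x y : E} (hx : g x = 1) (hy : g y = 0) :
    piCoeff q (x, y) = 2 * q g g (x, y) := by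
  have hxy : x ≠ y := by
    rintro rfl
    exact one_ne_zero (hx.symm.trans hy)
  rw [piCoeff, dif_pos hxy, apply_congr_of_eq_at hq hzero (g' := g) (h' := g)] <;>
    simp [separator_fst hxy, separator_snd hxy, hx, hy]

lemma apply_self_eq_coeff (hq : ∀ g h : C(E, ℝ), q g h = q h g)
    (hqval : ∀ (g h : C(E, ℝ)) (x y : E), q g h (x, y) = q g h (y, x))
    (hzero : ∀ (g h : C(E, ℝ)) (x y : E), g x = 0 → g y = 0 → q g h (x, y) = 0)
    (g : C(E, ℝ)) (x y : E) :
    q g g (x, y) = (1 / 2) * (piCoeff q (x, y) * g x ^ 2 + piCoeff q (y, x) * g y ^ 2 +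
      2 * betaCoeff q (x, y) * g x * g y) := by
  by_cases hxy : x = y
  · subst hxy
    rw [apply_diag_eq hq hzero, piCoeff_diag, betaCoeff_diag]
    ring
  · have hx := separator_fst hxy
    have hy := separator_snd hxy
    set e := separator ⟨(x, y), hxy⟩
    have hx' : (1 - e) x = 0 := by simp [hx]
    have hy' : (1 - e) y = 1 := by simp [hy]
    have h := fun f => apply_eq_of_separating hq hzero hx hy hx' hy' f f
    rw [betaCoeff, Prod.swap_prod_mk, piCoeff_eq hq hzero hx hy, piCoeff_eq hq hzero hy' hx',
      hqval _ _ y x, h 1, h g]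
    simp only [ContinuousMap.one_apply]
    ring

lemma continuousOn_piCoeff (hq : ∀ g h : C(E, ℝ), q g h = q h g)
    (hzero : ∀ (g h : C(E, ℝ)) (x y : E), g x = 0 → g y = 0 → q g h (x, y) = 0) :
    ContinuousOn (piCoeff q) {p : E × E | p.1 ≠ p.2} := by
  rintro ⟨x, y⟩ hxy
  obtain ⟨e, hx, hy, -⟩ := exists_continuousMap_eventually_one_zero hxy
  have hcont : ContinuousAt (fun p => 2 * q e e p) (x, y) := by fun_prop
  refine (hcont.congr ?_).continuousWithinAt
  filter_upwards [hx.prod_inl_nhds y, hy.prod_inr_nhds x] with p hp₁ hp₂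
  exact (piCoeff_eq hq hzero hp₁ hp₂).symm

lemma continuousOn_betaCoeff (hq : ∀ g h : C(E, ℝ), q g h = q h g)
    (hzero : ∀ (g h : C(E, ℝ)) (x y : E), g x = 0 → g y = 0 → q g h (x, y) = 0) :
    ContinuousOn (betaCoeff q) {p : E × E | p.1 ≠ p.2} := by
  have hpi := continuousOn_piCoeff hq hzero
  have hswap : ContinuousOn (fun p : E × E => piCoeff q p.swap) {p : E × E | p.1 ≠ p.2} :=
    hpi.comp continuous_swap.continuousOn fun p hp => Ne.symm hp
  exact (q 1 1).continuous.continuousOn.sub ((hpi.add hswap).div_const 2)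

lemma exists_bound_coeff [CompactSpace E] (hq : ∀ g h : C(E, ℝ), q g h = q h g)
    (hzero : ∀ (g h : C(E, ℝ)) (x y : E), g x = 0 → g y = 0 → q g h (x, y) = 0) :
    ∃ C : ℝ, ∀ p, |piCoeff q p| ≤ C ∧ |betaCoeff q p| ≤ C := by
  obtain ⟨C, hC⟩ := exists_bound_offDiag hq hzero
  have hpi : ∀ p, |piCoeff q p| ≤ 2 * |C| := by
    rintro ⟨x, y⟩
    by_cases hxy : x = y
    · subst hxy
      simp [piCoeff_diag]
    · rw [piCoeff, dif_pos hxy, abs_mul, abs_two]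
      have hnorm := norm_separator_le_one ⟨(x, y), hxy⟩
      refine mul_le_mul_of_nonneg_left ?_ zero_le_two
      calc _ ≤ C * ‖separator ⟨(x, y), hxy⟩‖ * ‖separator ⟨(x, y), hxy⟩‖ := hC x y hxy _ _
        _ ≤ |C| * 1 * 1 := by
          gcongr
          exact le_abs_self C
        _ = |C| := by ring
  refine ⟨2 * |C| + ‖q 1 1‖, fun p => ⟨(hpi p).trans (by simp), ?_⟩⟩
  have h₁ := abs_le.1 ((q 1 1).norm_coe_le_norm p)
  have h₂ := abs_le.1 (hpi p)
  have h₃ := abs_le.1 (hpi p.swap)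
  rw [betaCoeff, abs_le]
  constructor <;> linarith [h₁.1, h₁.2, h₂.1, h₂.2, h₃.1, h₃.2]

end Coefficients

section PositiveSemidefinite

/-- Averaging a vector over the fibres of `x` with respect to positive weights. -/
lemma exists_weighted_fibre_average {α : Type*} {n : ℕ} (x : Fin n → α) (c v : Fin n → ℝ)
    (hc : ∀ i, 0 < c i) :
    ∃ u : α → ℝ, ∀ F : α → ℝ, ∑ i, c i * u (x i) * F (x i) = ∑ i, v i * F (x i) := by
  classical
  refine ⟨fun a => (∑ j, if x j = a then v j else 0) / ∑ j, if x j = a then c j else 0,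
    fun F => ?_⟩
  have hpos : ∀ j, 0 < ∑ i, if x i = x j then c i else 0 := fun j =>
    Finset.sum_pos' (fun i _ => by split_ifs <;> simp [(hc i).le]) ⟨j, by simp [hc j]⟩
  calc _ = ∑ i, ∑ j, c i * F (x i) * (if x j = x i then v j else 0) /
        ∑ k, if x k = x i then c k else 0 := by
        refine Finset.sum_congr rfl fun i _ => ?_
        rw [← Finset.sum_div, ← Finset.mul_sum]
        ring
    _ = ∑ j, ∑ i, c i * F (x i) * (if x j = x i then v j else 0) /
        ∑ k, if x k = x i then c k else 0 := Finset.sum_comm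
    _ = ∑ j, ∑ i, v j * F (x j) * (if x i = x j then c i else 0) /
        ∑ k, if x k = x j then c k else 0 := by
        refine Finset.sum_congr rfl fun j _ => Finset.sum_congr rfl fun i _ => ?_
        by_cases hij : x i = x j
        · simp only [hij, if_true]
          ring
        · simp [hij, Ne.symm hij]
    _ = _ := by
        refine Finset.sum_congr rfl fun j _ => ?_
        rw [← Finset.sum_div, ← Finset.mul_sum, mul_div_assoc, div_self (hpos j).ne', mul_one]

variable {E : Type*} [MetricSpace E]

/-- Positivity of the quadratic form `g ↦ ∑ i, ∑ j, c i * c j * q(x i, x j)` associated with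
coefficients `π` and `β` yields the positivity condition on the coefficients. -/
lemma matrix_nonneg_of_sum_nonneg {π β : E × E → ℝ} (hπ : ∀ p, 0 ≤ π p)
    {n : ℕ} (x : Fin n → E) (c : Fin n → ℝ) (hc : ∀ i, 0 < c i)
    (hpos : ∀ g : C(E, ℝ), 0 ≤ ∑ i, ∑ j, c i * c j * ((1 / 2) * (π (x i, x j) * g (x i) ^ 2 +
      π (x j, x i) * g (x j) ^ 2 + 2 * β (x i, x j) * g (x i) * g (x j))))
    (v : Fin n → ℝ) :
    0 ≤ ∑ i, ∑ j, v i * v j *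
      (β (x i, x j) + if i = j then ∑ k, (c k / c i) * π (x i, x k) else 0) := by
  obtain ⟨u, hu⟩ := exists_weighted_fibre_average x c v hc
  obtain ⟨g, hg⟩ := exists_continuousMap_eqOn_finite (Set.finite_range x) u
  have hg' : ∀ i, g (x i) = u (x i) := fun i => hg _ ⟨i, rfl⟩
  let P : E → ℝ := fun z => ∑ k, c k * π (z, x k)
  have hP : ∀ z, 0 ≤ P z := fun z => Finset.sum_nonneg fun k _ => mul_nonneg (hc k).le (hπ _)
  have hβ : ∑ i, ∑ j, c i * c j * (β (x i, x j) * u (x i) * u (x j)) =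
      ∑ i, ∑ j, v i * v j * β (x i, x j) := by
    calc _ = ∑ i, c i * u (x i) * ∑ j, c j * u (x j) * β (x i, x j) := by
          simp only [Finset.mul_sum]
          exact Finset.sum_congr rfl fun i _ => Finset.sum_congr rfl fun j _ => by ring
      _ = ∑ i, c i * u (x i) * ∑ j, v j * β (x i, x j) :=
          Finset.sum_congr rfl fun i _ => by rw [hu fun z => β (x i, z)]
      _ = ∑ i, v i * ∑ j, v j * β (x i, x j) := hu fun z => ∑ j, v j * β (z, x j)
      _ = _ := by simp only [Finset.mul_sum, mul_assoc]
  have hπ₁ : ∑ i, ∑ j, c i * c j * (π (x i, x j) * u (x i) ^ 2) =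
      ∑ i, c i * u (x i) * (u (x i) * P (x i)) := by
    simp only [P, Finset.mul_sum]
    exact Finset.sum_congr rfl fun i _ => Finset.sum_congr rfl fun j _ => by ring
  have hπ₂ : ∑ i, ∑ j, c i * c j * (π (x j, x i) * u (x j) ^ 2) =
      ∑ i, c i * u (x i) * (u (x i) * P (x i)) := by
    rw [Finset.sum_comm, ← hπ₁]
    exact Finset.sum_congr rfl fun i _ => Finset.sum_congr rfl fun j _ => by ring
  have hform : ∑ i, ∑ j, c i * c j * ((1 / 2) * (π (x i, x j) * g (x i) ^ 2 +
      π (x j, x i) * g (x j) ^ 2 + 2 * β (x i, x j) * g (x i) * g (x j))) =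
      ∑ i, c i * u (x i) * (u (x i) * P (x i)) + ∑ i, ∑ j, v i * v j * β (x i, x j) := by
    rw [← hβ]
    have : ∀ a : ℝ, a = (a + a) / 2 := fun a => by ring
    rw [this (∑ i, c i * u (x i) * (u (x i) * P (x i)))]
    nth_rewrite 1 [← hπ₁]
    rw [← hπ₂]
    simp only [← Finset.sum_add_distrib, Finset.sum_div, hg']
    exact Finset.sum_congr rfl fun i _ => Finset.sum_congr rfl fun j _ => by ring
  have hdiag : ∑ i, c i * u (x i) * (u (x i) * P (x i)) ≤ ∑ i, v i ^ 2 / c i * P (x i) := by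
    have h := hu fun z => u z * P z
    have hle : ∑ i, (2 * (v i * (u (x i) * P (x i))) - c i * u (x i) * (u (x i) * P (x i))) ≤
        ∑ i, v i ^ 2 / c i * P (x i) := by
      refine Finset.sum_le_sum fun i _ => ?_
      have hsq : 0 ≤ (v i - c i * u (x i)) ^ 2 / c i * P (x i) :=
        mul_nonneg (div_nonneg (sq_nonneg _) (hc i).le) (hP _)
      have heq : (v i - c i * u (x i)) ^ 2 / c i * P (x i) = v i ^ 2 / c i * P (x i) -
          (2 * (v i * (u (x i) * P (x i))) - c i * u (x i) * (u (x i) * P (x i))) := by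
        field_simp [(hc i).ne']
        ring
      linarith
    rw [Finset.sum_sub_distrib, ← Finset.mul_sum, ← h] at hle
    linarith
  have hgoal : ∑ i, ∑ j, v i * v j *
      (β (x i, x j) + if i = j then ∑ k, (c k / c i) * π (x i, x k) else 0) =
      ∑ i, v i ^ 2 / c i * P (x i) + ∑ i, ∑ j, v i * v j * β (x i, x j) := by
    simp only [mul_add, Finset.sum_add_distrib, mul_ite, mul_zero, Finset.sum_ite_eq,
      Finset.mem_univ, if_true]
    rw [add_comm]
    congr 1
    refine Finset.sum_congr rfl fun i _ => ?_
    simp only [P, Finset.mul_sum]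
    exact Finset.sum_congr rfl fun k _ => by ring
  have h := hpos g
  rw [hform] at h
  rw [hgoal]
  linarith

end PositiveSemidefinite

section PositiveMaximumPrinciple

variable {E : Type*} [MetricSpace E] [CompactSpace E] [MeasurableSpace E] [BorelSpace E]
  {b₀ : C(E, ℝ) →ₗ[ℝ] ℝ} {b₁ : C(E, ℝ) →ₗ[ℝ] C(E, ℝ)}
  {q₀ : C(E, ℝ) →ₗ[ℝ] C(E, ℝ) →ₗ[ℝ] ℝ}
  {q₁ : C(E, ℝ) →ₗ[ℝ] C(E, ℝ) →ₗ[ℝ] C(E, ℝ)}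
  {q₂ : C(E, ℝ) →ₗ[ℝ] C(E, ℝ) →ₗ[ℝ] C(E × E, ℝ)}

lemma SatisfiesPMP.diag_nonneg (hPMP : SatisfiesPMP b₀ b₁ q₀ q₁ q₂) (g : C(E, ℝ)) (x : E) :
    0 ≤ q₂ g g (x, x) := by
  simpa using hPMP.sum_nonneg ![x] ![1] g

lemma SatisfiesPMP.piCoeff_nonneg (hPMP : SatisfiesPMP b₀ b₁ q₀ q₁ q₂)
    (hq₂ : ∀ g h : C(E, ℝ), q₂ g h = q₂ h g)
    (hq₂val : ∀ (g h : C(E, ℝ)) (x y : E), q₂ g h (x, y) = q₂ g h (y, x)) (p : E × E) :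
    0 ≤ piCoeff q₂ p := by
  obtain ⟨x, y⟩ := p
  by_cases hxy : x = y
  · subst hxy
    simp [piCoeff_diag]
  · rw [piCoeff, dif_pos hxy]
    set e := separator ⟨(x, y), hxy⟩
    have hyy : q₂ e e (y, y) = 0 :=
      hPMP.apply_eq_zero hq₂ hq₂val e e y y (separator_snd hxy) (separator_snd hxy)
    by_contra! hneg
    have h := hPMP.sum_nonneg ![x, y]
      ![1, (q₂ e e (x, x) / (-(2 * q₂ e e (x, y))) + 1).toNNReal] e
    have hdiv : 0 ≤ q₂ e e (x, x) / (-(2 * q₂ e e (x, y))) :=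
      div_nonneg (hPMP.diag_nonneg e x) (by linarith)
    have hmul := div_mul_cancel₀ (q₂ e e (x, x)) (neg_ne_zero.2 hneg.ne)
    simp only [Fin.sum_univ_two, Matrix.cons_val_zero, Matrix.cons_val_one, NNReal.coe_one, hyy,
      hq₂val e e y x, Real.coe_toNNReal _ (add_nonneg hdiv zero_le_one)] at h
    nlinarith

end PositiveMaximumPrinciple

/-- If `L` satisfies the positive maximum principle on `M₊(E)`, then `q₂` admits a
`(β,π)`-representation. -/
theorem stmt_13 {E : Type*} [MetricSpace E] [CompactSpace E] [MeasurableSpace E] [BorelSpace E]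
    (b₀ : C(E, ℝ) →ₗ[ℝ] ℝ) (b₁ : C(E, ℝ) →ₗ[ℝ] C(E, ℝ))
    (q₀ : C(E, ℝ) →ₗ[ℝ] C(E, ℝ) →ₗ[ℝ] ℝ)
    (q₁ : C(E, ℝ) →ₗ[ℝ] C(E, ℝ) →ₗ[ℝ] C(E, ℝ))
    (q₂ : C(E, ℝ) →ₗ[ℝ] C(E, ℝ) →ₗ[ℝ] C(E × E, ℝ))
    (hq₀ : ∀ g h : C(E, ℝ), q₀ g h = q₀ h g)
    (hq₁ : ∀ g h : C(E, ℝ), q₁ g h = q₁ h g)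
    (hq₂ : ∀ g h : C(E, ℝ), q₂ g h = q₂ h g)
    (hq₂val : ∀ (g h : C(E, ℝ)) (x y : E), q₂ g h (x, y) = q₂ g h (y, x))
    (hPMP : SatisfiesPMP b₀ b₁ q₀ q₁ q₂) :
    ∃ π β : E × E → ℝ,
      (∀ p, 0 ≤ π p) ∧ (∀ x : E, π (x, x) = 0) ∧
      (∀ x y : E, β (x, y) = β (y, x)) ∧ (∀ x : E, 0 ≤ β (x, x)) ∧
      (∃ C : ℝ, ∀ p, |π p| ≤ C ∧ |β p| ≤ C) ∧
      ContinuousOn π {p : E × E | p.1 ≠ p.2} ∧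
      ContinuousOn β {p : E × E | p.1 ≠ p.2} ∧
      (∀ (g : C(E, ℝ)) (x y : E),
        q₂ g g (x, y) =
          (1 / 2) * (π (x, y) * g x ^ 2 + π (y, x) * g y ^ 2 + 2 * β (x, y) * g x * g y)) ∧
      (∀ (n : ℕ) (x : Fin n → E) (c : Fin n → ℝ), (∀ i, 0 < c i) →
        ∀ v : Fin n → ℝ,
          0 ≤ ∑ i, ∑ j, v i * v j *
            (β (x i, x j) + if i = j then ∑ k, (c k / c i) * π (x i, x k) else 0)) := by
  have hzero := hPMP.apply_eq_zero hq₂ hq₂val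
  have hpi := hPMP.piCoeff_nonneg hq₂ hq₂val
  refine ⟨piCoeff q₂, betaCoeff q₂, hpi, piCoeff_diag, betaCoeff_symm hq₂val,
    fun x => (betaCoeff_diag (q := q₂) x).symm ▸ hPMP.diag_nonneg 1 x,
    exists_bound_coeff hq₂ hzero, continuousOn_piCoeff hq₂ hzero,
    continuousOn_betaCoeff hq₂ hzero, apply_self_eq_coeff hq₂ hq₂val hzero,
    fun n x c hc => matrix_nonneg_of_sum_nonneg hpi x c hc fun g => ?_⟩
  have h := hPMP.sum_nonneg x (fun i => ⟨c i, (hc i).le⟩) g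
  simp only [apply_self_eq_coeff hq₂ hq₂val hzero] at h
  exact h
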